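/- Assume $q \in L^\infty(0,1)$ is real-valued and $\chi_2 \in L^\infty(0,1)$ with $\chi_2 > 0$ a.e. in $(0,1)$. There exists $\delta > 0$ depending only on $q$ such that: if $\omega \in (0, \delta]$, $\bm{u} = (u_1, u_2) \in H^2(0,1) \times L^2(0,1)$ with $u_1$ real-valued, and $T_\omega(\bm{u}) = 0$, then $\bm{u} = 0$. Moreover when $q \equiv 1$ one may take $\delta = \pi/2$. -/

import Mathlib

open MeasureTheory Set
open scoped InnerProductSpace

/-- Auxiliary predicate: "for every model `X` of `H²(0,1) × L²(0,1)` (given by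
coordinate maps `F1, D2, F2` with the paper's inner product, `H²`-structure,
integrability and surjectivity hypotheses), every `L^∞` susceptibility `χ₁`,
every a.e. positive `L^∞` susceptibility `χ₂`, every `ω ∈ (0, δ]`, and every
weak-form second-harmonic operator `T = T_ω` built from `q, χ₁, χ₂`, any
`u = (u₁,u₂)` with `u₁` real-valued and `T u = 0` must vanish." -/
def SHGRealNontrivialFree (q : ℝ → ℝ) (δ : ℝ) : Prop :=
  ∀ (X : Type) [NormedAddCommGroup X] [InnerProductSpace ℂ X],
    ∀ F1 D2 F2 : X →ₗ[ℂ] (ℝ → ℂ),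
    (∀ u v : X, ⟪u, v⟫_ℂ =
      ∫ x in (0:ℝ)..1,
        ((starRingEnd ℂ) (F1 u x) * F1 v x +
          (starRingEnd ℂ) (D2 u x) * D2 v x +
          (starRingEnd ℂ) (F2 u x) * F2 v x)) →
    (∀ u : X, ∃ g : ℝ → ℂ,
      (∀ x ∈ Icc (0:ℝ) 1, F1 u x = F1 u 0 + ∫ t in (0:ℝ)..x, g t) ∧
      (∀ x ∈ Icc (0:ℝ) 1, g x = g 0 + ∫ t in (0:ℝ)..x, D2 u t) ∧
      IntervalIntegrable g volume 0 1) →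
    (∀ u : X,
      IntervalIntegrable (fun x => ‖F1 u x‖ ^ 2) volume 0 1 ∧
      IntervalIntegrable (D2 u) volume 0 1 ∧
      IntervalIntegrable (fun x => ‖D2 u x‖ ^ 2) volume 0 1 ∧
      IntervalIntegrable (F2 u) volume 0 1 ∧
      IntervalIntegrable (fun x => ‖F2 u x‖ ^ 2) volume 0 1) →
    (∀ f g d h : ℝ → ℂ,
      (∀ x ∈ Icc (0:ℝ) 1, f x = f 0 + ∫ t in (0:ℝ)..x, g t) →
      (∀ x ∈ Icc (0:ℝ) 1, g x = g 0 + ∫ t in (0:ℝ)..x, d t) →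
      IntervalIntegrable g volume 0 1 →
      IntervalIntegrable d volume 0 1 →
      IntervalIntegrable (fun x => ‖d x‖ ^ 2) volume 0 1 →
      Measurable h →
      IntervalIntegrable (fun x => ‖h x‖ ^ 2) volume 0 1 →
      ∃ u : X, (∀ x ∈ Icc (0:ℝ) 1, F1 u x = f x) ∧
        (∀ᵐ x ∂(volume.restrict (Ioo (0:ℝ) 1)), D2 u x = d x) ∧
        (∀ᵐ x ∂(volume.restrict (Ioo (0:ℝ) 1)), F2 u x = h x)) →
    ∀ χ₁ χ₂ : ℝ → ℝ,
      Measurable χ₁ → (∃ M : ℝ, ∀ x ∈ Icc (0:ℝ) 1, |χ₁ x| ≤ M) →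
      Measurable χ₂ → (∃ M : ℝ, ∀ x ∈ Icc (0:ℝ) 1, |χ₂ x| ≤ M) →
      (∀ᵐ x ∂(volume.restrict (Ioo (0:ℝ) 1)), 0 < χ₂ x) →
      ∀ ω : ℝ, ω ∈ Ioc (0:ℝ) δ →
        ∀ T : X → X,
          (∀ u φ : X, ⟪φ, T u⟫_ℂ =
            (∫ x in (0:ℝ)..1,
              ((D2 u x + (ω : ℂ) ^ 2 * (q x : ℂ) * F1 u x) *
                  (starRingEnd ℂ) (F2 φ x) +
                (χ₁ x : ℂ) * (ω : ℂ) ^ 2 * F2 u x * (starRingEnd ℂ) (F1 u x) *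
                  (starRingEnd ℂ) (F2 φ x))) +
            ∫ x in (0:ℝ)..1,
              (F2 u x * ((starRingEnd ℂ) (D2 φ x) +
                  4 * (ω : ℂ) ^ 2 * (q x : ℂ) * (starRingEnd ℂ) (F1 φ x)) +
                (χ₂ x : ℂ) * (ω : ℂ) ^ 2 * (F1 u x) ^ 2 *
                  (starRingEnd ℂ) (F1 φ x))) →
          ∀ u : X, (∀ x ∈ Icc (0:ℝ) 1, (F1 u x).im = 0) → T u = 0 → u = 0

lemma exp_bound (L C : ℝ) (hL : 0 < L) (hC : 0 ≤ C) (f : ℝ → ℂ) (x : ℝ) (hx : 0 ≤ x)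
    (hf : ∀ t ∈ Ioc 0 x, ‖f t‖ ≤ C * Real.exp (L * t)) :
    ‖∫ t in (0:ℝ)..x, f t‖ ≤ C / L * Real.exp (L * x) := by
  have h1 : ‖∫ t in (0:ℝ)..x, f t‖ ≤ ∫ t in (0:ℝ)..x, C * Real.exp (L * t) :=
    intervalIntegral.norm_integral_le_of_norm_le hx (ae_of_all _ hf)
      (by apply Continuous.intervalIntegrable; fun_prop)
  have h2 : ∫ t in (0:ℝ)..x, C * Real.exp (L * t) =
      C / L * Real.exp (L * x) - C / L * Real.exp (L * 0) := by
    apply intervalIntegral.integral_eq_sub_of_hasDerivAt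
    · intro t _
      have h : HasDerivAt (fun t => C / L * Real.exp (L * t))
          (C / L * (Real.exp (L * t) * (L * 1))) t :=
        ((((hasDerivAt_id t).const_mul L).exp).const_mul (C / L))
      have e : C * Real.exp (L * t) = C / L * (Real.exp (L * t) * (L * 1)) := by field_simp
      rw [e]; exact h
    · apply Continuous.intervalIntegrable; fun_prop
  have h3 : 0 ≤ C / L * Real.exp (L * 0) := by positivity
  linarith

lemma volterra (q : ℝ → ℝ) (hq : Measurable q) (M : ℝ) (hM : ∀ x, |q x| ≤ M) (l : ℝ)
    (hl : 0 ≤ l) (F : ℝ → ℂ) (hF : Continuous F) :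
    ∃ w : ℝ → ℂ, Continuous w ∧ ∀ x ∈ Icc (0:ℝ) 1,
      w x = F x - l * ∫ s in (0:ℝ)..x, ∫ t in (0:ℝ)..s, (q t : ℂ) * w t := by
  have hM0 : 0 ≤ M := (abs_nonneg _).trans (hM 0)
  obtain ⟨L, hL1, hL⟩ : ∃ L : ℝ, 1 ≤ L ∧ l * (M / L / L) ≤ 1/2 := by
    refine ⟨1 + 2 * l * M, by nlinarith [mul_nonneg hl hM0], ?_⟩
    have h0 := mul_nonneg hl hM0
    rw [div_div, mul_div_assoc', div_le_iff₀ (by positivity)]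
    nlinarith
  have hL0 : 0 < L := by linarith
  -- extension
  let P : ℝ → Icc (0:ℝ) 1 := projIcc 0 1 zero_le_one
  have hP : Continuous P := continuous_projIcc
  let e : ℝ → ℂ := fun t => ((Real.exp (L * t) : ℝ) : ℂ)
  have he : Continuous e := by fun_prop
  have hint : ∀ v : ℝ → ℂ, Continuous v → ∀ a b : ℝ,
      IntervalIntegrable (fun t => (q t : ℂ) * v t) volume a b := by
    intro v hv a b
    have h1 : IntervalIntegrable v volume a b := hv.intervalIntegrable _ _
    rw [intervalIntegrable_iff] at h1 ⊢
    refine h1.bdd_mul (c := M) (by fun_prop) (ae_of_all _ fun x => ?_)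
    simpa using hM x
  have hcont : ∀ v : ℝ → ℂ, Continuous v →
      Continuous (fun s => ∫ t in (0:ℝ)..s, (q t : ℂ) * v t) := fun v hv =>
    intervalIntegral.continuous_primitive (hint v hv) 0
  have hcont2 : ∀ v : ℝ → ℂ, Continuous v →
      Continuous (fun x => ∫ s in (0:ℝ)..x, ∫ t in (0:ℝ)..s, (q t : ℂ) * v t) := fun v hv =>
    intervalIntegral.continuous_primitive (fun a b => (hcont v hv).intervalIntegrable a b) 0
  let ext : C(Icc (0:ℝ) 1, ℂ) → ℝ → ℂ := fun v t => e t * v (P t)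
  have hext : ∀ v, Continuous (ext v) := fun v => he.mul (v.continuous.comp hP)
  let Φ : C(Icc (0:ℝ) 1, ℂ) → C(Icc (0:ℝ) 1, ℂ) := fun v =>
    ⟨fun x => ((Real.exp (-(L * x)) : ℝ) : ℂ) *
      (F x - l * ∫ s in (0:ℝ)..x, ∫ t in (0:ℝ)..s, (q t : ℂ) * ext v t), by
        have := (hcont2 _ (hext v)).comp (continuous_subtype_val (p := fun x => x ∈ Icc (0:ℝ) 1))
        have h2 := hF.comp (continuous_subtype_val (p := fun x => x ∈ Icc (0:ℝ) 1))
        refine Continuous.mul (by fun_prop) (h2.sub (continuous_const.mul this))⟩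
  have hΦ : ContractingWith (1/2) Φ := by
    refine ⟨by rw [← NNReal.coe_lt_coe]; norm_num, LipschitzWith.of_dist_le_mul fun v w => ?_⟩
    rw [ContinuousMap.dist_le (by positivity)]
    intro x
    have hx := x.2
    have hD : ∀ y, ‖v y - w y‖ ≤ dist v w := fun y => by
      rw [← dist_eq_norm]; exact ContinuousMap.dist_apply_le_dist y
    have hin : ∀ s ∈ Ioc 0 (x:ℝ), ‖∫ t in (0:ℝ)..s, (q t : ℂ) * (ext v t - ext w t)‖ ≤
        M * dist v w / L * Real.exp (L * s) := by
      intro s hs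
      apply exp_bound L _ hL0 (by positivity) _ _ hs.1.le
      intro t ht
      have : (q t : ℂ) * (ext v t - ext w t) = q t * (v (P t) - w (P t)) * e t := by
        simp only [ext]; ring
      rw [this, norm_mul, norm_mul]
      have h3 : ‖e t‖ = Real.exp (L * t) := by
        simp only [e]; rw [Complex.norm_real, Real.norm_of_nonneg (Real.exp_pos _).le]
      rw [h3]
      gcongr
      · simpa using hM t
      · exact hD _
    have hout := exp_bound L _ hL0 (by positivity) _ _ hx.1 hin
    have hsub : (∫ s in (0:ℝ)..x, ∫ t in (0:ℝ)..s, (q t : ℂ) * (ext v t - ext w t)) =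
        (∫ s in (0:ℝ)..x, ∫ t in (0:ℝ)..s, (q t : ℂ) * ext v t) -
        (∫ s in (0:ℝ)..x, ∫ t in (0:ℝ)..s, (q t : ℂ) * ext w t) := by
      rw [← intervalIntegral.integral_sub ((hcont _ (hext v)).intervalIntegrable _ _)
        ((hcont _ (hext w)).intervalIntegrable _ _)]
      congr 1; ext s
      rw [← intervalIntegral.integral_sub (hint _ (hext v) _ _) (hint _ (hext w) _ _)]
      congr 1; ext t; ring
    rw [dist_eq_norm]
    have h4 : Φ v x - Φ w x = -(((Real.exp (-(L * x)) : ℝ) : ℂ) * (l *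
      ∫ s in (0:ℝ)..x, ∫ t in (0:ℝ)..s, (q t : ℂ) * (ext v t - ext w t))) := by
      rw [hsub]; simp only [Φ, ContinuousMap.coe_mk]; ring
    rw [h4, norm_neg, norm_mul, norm_mul, Complex.norm_real, Complex.norm_real,
      Real.norm_of_nonneg (Real.exp_pos _).le, Real.norm_of_nonneg hl]
    calc _ ≤ Real.exp (-(L * x)) * (l * (M * dist v w / L / L * Real.exp (L * x))) := by gcongr
      _ = (l * (M / L / L)) * dist v w * (Real.exp (-(L * x)) * Real.exp (L * x)) := by ring
      _ = (l * (M / L / L)) * dist v w := by rw [← Real.exp_add]; simp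
      _ ≤ _ := by
        have : (((1/2 : NNReal)) : ℝ) = 1/2 := by norm_num
        rw [this]; gcongr
  let v := hΦ.fixedPoint
  have hv : Φ v = v := hΦ.fixedPoint_isFixedPt
  refine ⟨ext v, hext v, fun x hx => ?_⟩
  have h5 : P x = ⟨x, hx⟩ := projIcc_of_mem _ hx
  have h6 : ext v x = e x * Φ v ⟨x, hx⟩ := by simp only [ext]; rw [h5, hv]
  rw [h6]
  simp only [Φ, ContinuousMap.coe_mk, e]
  rw [← mul_assoc, ← Complex.ofReal_mul, ← Real.exp_add]; simp


lemma ode_solve (q : ℝ → ℝ) (hq : Measurable q) (M : ℝ) (hM : ∀ x ∈ Icc (0:ℝ) 1, |q x| ≤ M)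
    (l : ℝ) (hl : 0 ≤ l) (a : ℂ) (k : ℝ → ℂ) (hk : IntervalIntegrable k volume 0 1) :
    ∃ w g : ℝ → ℂ, Continuous w ∧ (∀ x ∈ Icc (0:ℝ) 1, w x = w 0 + ∫ t in (0:ℝ)..x, g t) ∧
      (∀ x ∈ Icc (0:ℝ) 1, g x = g 0 + ∫ t in (0:ℝ)..x, (k t - l * q t * w t)) ∧
      Continuous g ∧ w 0 = 0 ∧ g 0 = a := by
  have hM0 : 0 ≤ M := (abs_nonneg _).trans (hM 0 (by simp))
  let p : ℝ → ℝ := (Icc (0:ℝ) 1).indicator q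
  have hp : Measurable p := hq.indicator measurableSet_Icc
  have hpM : ∀ x, |p x| ≤ M := by
    intro x
    by_cases hx : x ∈ Icc (0:ℝ) 1
    · simpa [p, indicator_of_mem hx] using hM x hx
    · simpa [p, indicator_of_notMem hx] using hM0
  let K : ℝ → ℂ := (Ioc (0:ℝ) 1).indicator k
  have hK : ∀ a b : ℝ, IntervalIntegrable K volume a b := by
    intro a b
    have : Integrable K volume := by
      rw [intervalIntegrable_iff_integrableOn_Ioc_of_le zero_le_one] at hk
      exact hk.integrable_indicator measurableSet_Ioc
    exact this.intervalIntegrable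
  let H : ℝ → ℂ := fun s => ∫ t in (0:ℝ)..s, K t
  have hH : Continuous H := intervalIntegral.continuous_primitive hK 0
  let F : ℝ → ℂ := fun x => ∫ s in (0:ℝ)..x, (a + H s)
  have haH : Continuous fun s => a + H s := continuous_const.add hH
  have hF : Continuous F :=
    intervalIntegral.continuous_primitive (fun c d => haH.intervalIntegrable c d) 0
  obtain ⟨w, hw, hwe⟩ := volterra p hp M hpM l hl F hF
  have hint : ∀ a b : ℝ, IntervalIntegrable (fun t => (p t : ℂ) * w t) volume a b := by
    intro a b
    have h1 : IntervalIntegrable w volume a b := hw.intervalIntegrable _ _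
    rw [intervalIntegrable_iff] at h1 ⊢
    refine h1.bdd_mul (c := M) (by fun_prop) (ae_of_all _ fun x => ?_)
    simpa using hpM x
  let Q : ℝ → ℂ := fun s => ∫ t in (0:ℝ)..s, (p t : ℂ) * w t
  have hQ : Continuous Q := intervalIntegral.continuous_primitive hint 0
  have hw0 : w 0 = 0 := by
    rw [hwe 0 (by simp)]; simp [F]
  refine ⟨w, fun s => a + H s - l * Q s, hw, ?_, ?_, haH.sub (continuous_const.mul hQ), hw0, ?_⟩
  · intro x hx
    rw [hwe x hx, hw0, zero_add, intervalIntegral.integral_sub (haH.intervalIntegrable _ _)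
      ((hQ.intervalIntegrable _ _).const_mul _), intervalIntegral.integral_const_mul]
  · intro x hx
    have e1 : (∫ t in (0:ℝ)..x, (k t - l * q t * w t)) =
        ∫ t in (0:ℝ)..x, (K t - l * (p t * w t)) := by
      apply intervalIntegral.integral_congr_ae
      refine ae_of_all _ fun t ht => ?_
      rw [uIoc_of_le hx.1] at ht
      have h1 : t ∈ Ioc (0:ℝ) 1 := ⟨ht.1, ht.2.trans hx.2⟩
      simp only [K, p, indicator_of_mem h1, indicator_of_mem (Ioc_subset_Icc_self h1)]
      ring
    rw [e1, intervalIntegral.integral_sub (hK _ _) ((hint _ _).const_mul _),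
      intervalIntegral.integral_const_mul]
    simp only [H, Q, intervalIntegral.integral_same]
    ring
  · simp [H, Q]

lemma ode_pos (q : ℝ → ℝ) (M : ℝ) (hM : ∀ x ∈ Icc (0:ℝ) 1, |q x| ≤ M)
    (l : ℝ) (hl : 0 ≤ l) (hlM : l * M ≤ 1 / 4) (w g : ℝ → ℂ) (hw : Continuous w)
    (hg : Continuous g)
    (h1 : ∀ x ∈ Icc (0:ℝ) 1, w x = w 0 + ∫ t in (0:ℝ)..x, g t)
    (h2 : ∀ x ∈ Icc (0:ℝ) 1, g x = g 0 + ∫ t in (0:ℝ)..x, (0 - l * q t * w t))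
    (hw0 : w 0 = 0) (hg0 : g 0 = 1) : ∀ x ∈ Ioo (0:ℝ) 1, 0 < (w x).re := by
  have hM0 : 0 ≤ M := (abs_nonneg _).trans (hM 0 (by simp))
  obtain ⟨y, hy, hmax⟩ := (isCompact_Icc (a := (0:ℝ)) (b := 1)).exists_isMaxOn
    ⟨0, by simp⟩ hw.norm.continuousOn
  set S := ‖w y‖ with hS
  have hS0 : 0 ≤ S := norm_nonneg _
  have hbd : ∀ x ∈ Icc (0:ℝ) 1, ‖w x‖ ≤ S := fun x hx => hmax hx
  have hg1 : ∀ x ∈ Icc (0:ℝ) 1, ‖g x - 1‖ ≤ l * M * S := by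
    intro x hx
    rw [h2 x hx, hg0, add_sub_cancel_left]
    have := intervalIntegral.norm_integral_le_of_norm_le_const (a := 0) (b := x)
      (f := fun t => 0 - (l:ℂ) * q t * w t) (C := l * M * S) (fun t ht => by
        rw [uIoc_of_le hx.1] at ht
        have ht' : t ∈ Icc (0:ℝ) 1 := ⟨ht.1.le, ht.2.trans hx.2⟩
        rw [zero_sub, norm_neg, norm_mul, norm_mul, Complex.norm_real, Complex.norm_real,
          Real.norm_of_nonneg hl, Real.norm_eq_abs]
        have := hM t ht'
        have := hbd t ht'
        gcongr)
    rw [sub_zero, abs_of_nonneg hx.1] at this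
    exact this.trans (mul_le_of_le_one_right (by positivity) hx.2)
  have hw1 : ∀ x ∈ Icc (0:ℝ) 1, ‖w x - x‖ ≤ l * M * S * x := by
    intro x hx
    have e : w x - x = ∫ t in (0:ℝ)..x, (g t - 1) := by
      rw [intervalIntegral.integral_sub (hg.intervalIntegrable _ _) (by simp), h1 x hx, hw0]
      simp
    rw [e]
    have := intervalIntegral.norm_integral_le_of_norm_le_const (a := 0) (b := x)
      (f := fun t => g t - 1) (C := l * M * S) (fun t ht => by
        rw [uIoc_of_le hx.1] at ht
        exact hg1 t ⟨ht.1.le, ht.2.trans hx.2⟩)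
    rwa [sub_zero, abs_of_nonneg hx.1] at this
  have hlMS : l * M * S ≤ 1 / 4 * S := by gcongr
  have hS2 : S ≤ 2 := by
    have a1 := hw1 y hy
    have a2 : S ≤ ‖w y - y‖ + ‖(y:ℂ)‖ := by
      rw [hS]; simpa using norm_add_le (w y - y) (y:ℂ)
    rw [Complex.norm_real, Real.norm_of_nonneg hy.1] at a2
    have a3 : l * M * S * y ≤ l * M * S := mul_le_of_le_one_right (by positivity) hy.2
    linarith [hy.2]
  intro x hx
  have a1 := hw1 x ⟨hx.1.le, hx.2.le⟩
  have a2 := Complex.abs_re_le_norm (w x - x)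
  rw [Complex.sub_re, Complex.ofReal_re] at a2
  have a3 := abs_le.1 (a2.trans a1)
  have a4 : l * M * S * x ≤ 1 / 2 * x := by
    have := hx.1.le
    gcongr
    linarith
  linarith [a3.1, hx.1]

lemma ae_zero_of_primitive (h : ℝ → ℂ) (hi : IntervalIntegrable h volume 0 1)
    (h0 : ∀ x ∈ Icc (0:ℝ) 1, ∫ t in (0:ℝ)..x, h t = 0) :
    ∀ᵐ x ∂(volume.restrict (Ioo (0:ℝ) 1)), h x = 0 := by
  rw [ae_restrict_iff' measurableSet_Ioo]
  filter_upwards [hi.ae_hasDerivAt_integral] with x hx hx1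
  have hx2 := hx (by rw [uIcc_of_le zero_le_one]; exact Ioo_subset_Icc_self hx1) 0 (by simp)
  have hx3 : HasDerivAt (fun x => ∫ t in (0:ℝ)..x, h t) 0 x := by
    refine (hasDerivAt_const x (0:ℂ)).congr_of_eventuallyEq ?_
    filter_upwards [Ioo_mem_nhds hx1.1 hx1.2] with y hy
    exact h0 y (Ioo_subset_Icc_self hy)
  exact hx2.unique hx3

lemma cont_of_prim (f g : ℝ → ℂ) (hg : IntervalIntegrable g volume 0 1)
    (hf : ∀ x ∈ Icc (0:ℝ) 1, f x = f 0 + ∫ t in (0:ℝ)..x, g t) :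
    ContinuousOn f (Icc 0 1) := by
  have := intervalIntegral.continuousOn_primitive_interval' hg left_mem_uIcc
  rw [uIcc_of_le zero_le_one] at this
  exact (continuousOn_const.add this).congr hf

lemma eqOn_zero (f : ℝ → ℂ) (hf : ContinuousOn f (Icc 0 1))
    (h : ∀ᵐ x ∂(volume.restrict (Ioo (0:ℝ) 1)), f x = 0) : ∀ x ∈ Icc (0:ℝ) 1, f x = 0 := by
  rw [Measure.restrict_congr_set Ioo_ae_eq_Icc] at h
  exact Measure.eqOn_Icc_of_ae_eq volume zero_ne_one (g := fun _ => (0:ℂ)) h hf continuousOn_const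

lemma int_congr (f g : ℝ → ℂ) (h : ∀ᵐ x ∂(volume.restrict (Ioo (0:ℝ) 1)), f x = g x) :
    ∫ x in (0:ℝ)..1, f x = ∫ x in (0:ℝ)..1, g x := by
  rw [restrict_Ioo_eq_restrict_Ioc] at h
  rw [intervalIntegral.integral_of_le zero_le_one, intervalIntegral.integral_of_le zero_le_one]
  exact integral_congr_ae h

lemma int_zero (f : ℝ → ℂ) (h : ∀ᵐ x ∂(volume.restrict (Ioo (0:ℝ) 1)), f x = 0) :
    ∫ x in (0:ℝ)..1, f x = 0 := by
  rw [int_congr f (fun _ => 0) h]; simp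

lemma ae_of_int_zero (f : ℝ → ℝ) (hi : IntervalIntegrable f volume 0 1)
    (hf : ∀ᵐ x ∂(volume.restrict (Ioo (0:ℝ) 1)), 0 ≤ f x)
    (h : ∫ x in (0:ℝ)..1, f x = 0) :
    ∀ᵐ x ∂(volume.restrict (Ioo (0:ℝ) 1)), f x = 0 := by
  rw [restrict_Ioo_eq_restrict_Ioc] at hf ⊢
  exact (intervalIntegral.integral_eq_zero_iff_of_le_of_nonneg_ae zero_le_one hf hi).1 h

lemma core (q : ℝ → ℝ) (hq : Measurable q) (M : ℝ) (hM : ∀ x ∈ Icc (0:ℝ) 1, |q x| ≤ M) (δ : ℝ)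
    (hz : ∀ ω ∈ Ioc (0:ℝ) δ, ∃ z g : ℝ → ℂ, Continuous z ∧
      (∀ x ∈ Icc (0:ℝ) 1, z x = z 0 + ∫ t in (0:ℝ)..x, g t) ∧
      (∀ x ∈ Icc (0:ℝ) 1, g x = g 0 +
        ∫ t in (0:ℝ)..x, (0 - ((4 * ω ^ 2 : ℝ) : ℂ) * q t * z t)) ∧
      Continuous g ∧ ∀ x ∈ Ioo (0:ℝ) 1, 0 < (z x).re) :
    SHGRealNontrivialFree q δ := by
  intro X _ _ F1 D2 F2 hinner hH2 hint hsurj χ₁ χ₂ _ _ hχ2 ⟨M2, hM2⟩ hχpos ω hω T hT u hu hTu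
  have hT0 : ∀ φ : X, (∀ᵐ x ∂(volume.restrict (Ioo (0:ℝ) 1)), F2 φ x = 0) →
      ∫ x in (0:ℝ)..1,
              (F2 u x * ((starRingEnd ℂ) (D2 φ x) +
                  4 * (ω : ℂ) ^ 2 * (q x : ℂ) * (starRingEnd ℂ) (F1 φ x)) +
                (χ₂ x : ℂ) * (ω : ℂ) ^ 2 * (F1 u x) ^ 2 *
                  (starRingEnd ℂ) (F1 φ x)) = 0 := by
    intro φ hφ
    have h := hT u φ
    rw [hTu, inner_zero_right, int_zero _ (by
      filter_upwards [hφ] with x hx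
      rw [hx]; simp), zero_add] at h
    exact h.symm
  -- solving the test problem with right-hand side `k`
  have hw2 : ∀ w k : ℝ → ℂ, Continuous w → IntervalIntegrable k volume 0 1 →
      IntervalIntegrable (fun x => ‖k x‖ ^ 2) volume 0 1 →
      IntervalIntegrable (fun t => k t - ((4 * ω ^ 2 : ℝ) : ℂ) * q t * w t) volume 0 1 ∧
      IntervalIntegrable (fun t => ‖k t - ((4 * ω ^ 2 : ℝ) : ℂ) * q t * w t‖ ^ 2)
        volume 0 1 := by
    intro w k hw hk hk2
    rw [intervalIntegrable_iff_integrableOn_Ioc_of_le zero_le_one] at hk hk2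
    rw [intervalIntegrable_iff_integrableOn_Ioc_of_le zero_le_one,
      intervalIntegrable_iff_integrableOn_Ioc_of_le zero_le_one]
    have m1 : MemLp k 2 (volume.restrict (Ioc (0:ℝ) 1)) :=
      (memLp_two_iff_integrable_sq_norm hk.aestronglyMeasurable).2 hk2
    obtain ⟨C, hC⟩ := (isCompact_Icc (a := (0:ℝ)) (b := 1)).exists_bound_of_continuousOn
      hw.continuousOn
    have m2 : MemLp (fun t => ((4 * ω ^ 2 : ℝ) : ℂ) * q t * w t) 2
        (volume.restrict (Ioc (0:ℝ) 1)) := by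
      refine MemLp.of_bound (C := 4 * ω ^ 2 * M * C)
        (Measurable.aestronglyMeasurable (by have := hw.measurable; fun_prop)) ?_
      rw [ae_restrict_iff' measurableSet_Ioc]
      refine ae_of_all _ fun t ht => ?_
      have a1 := hM t (Ioc_subset_Icc_self ht)
      have a2 := hC t (Ioc_subset_Icc_self ht)
      have a3 := (abs_nonneg _).trans a1
      rw [norm_mul, norm_mul, Complex.norm_real, Complex.norm_real,
          Real.norm_of_nonneg (by positivity), Real.norm_eq_abs]
      gcongr
    have m3 := m1.sub m2
    exact ⟨m3.integrable (by norm_num),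
      (memLp_two_iff_integrable_sq_norm m3.aestronglyMeasurable).1 m3⟩
  -- continuity
  obtain ⟨g, hg1, hg2, hgi⟩ := hH2 u
  obtain ⟨-, hD2i, hD2s, hF2i, hF2s⟩ := hint u
  have hu1c : ContinuousOn (F1 u) (Icc 0 1) := cont_of_prim _ _ hgi hg1
  have hgc : ContinuousOn g (Icc 0 1) := cont_of_prim _ _ hD2i hg2
  have hu1 : ∀ᵐ x ∂(volume.restrict (Ioo (0:ℝ) 1)), F1 u x = 0 := by
    obtain ⟨z, zg, hzc, hz1, hz2, hzgc, hzpos⟩ := hz ω hω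
    obtain ⟨hd1, hd2⟩ := hw2 z (fun _ => 0) hzc (by simp) (by simp)
    obtain ⟨φ, h1, h2, h3⟩ := hsurj z zg _ (fun _ => 0) hz1 hz2 (hzgc.intervalIntegrable _ _)
      hd1 hd2 measurable_const (by simp)
    have h := hT0 φ h3
    rw [int_congr _ (fun x => (χ₂ x : ℂ) * ((ω : ℂ) ^ 2 * (F1 u x) ^ 2 *
                  (starRingEnd ℂ) (z x))) (by
      filter_upwards [h2, ae_restrict_mem measurableSet_Ioo] with x hx hx'
      rw [hx, h1 x (Ioo_subset_Icc_self hx')]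
      simp only [map_sub, map_mul, map_zero, Complex.conj_ofReal]
      push_cast
      ring)] at h
    have hI : IntervalIntegrable (fun x => (χ₂ x : ℂ) * ((ω : ℂ) ^ 2 * (F1 u x) ^ 2 *
                  (starRingEnd ℂ) (z x))) volume 0 1 := by
      have hc : ContinuousOn (fun x => ((ω : ℂ) ^ 2 * (F1 u x) ^ 2 *
                  (starRingEnd ℂ) (z x))) (Icc 0 1) := by
        have : Continuous fun x => (starRingEnd ℂ) (z x) := Complex.continuous_conj.comp hzc
        fun_prop
      have hci := hc.integrableOn_Icc (μ := volume)
      rw [intervalIntegrable_iff_integrableOn_Ioc_of_le zero_le_one]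
      refine (hci.mono_set Ioc_subset_Icc_self).bdd_mul (c := M2) (by fun_prop) ?_
      rw [ae_restrict_iff' measurableSet_Ioc]
      refine ae_of_all _ fun t ht => ?_
      simpa using hM2 t (Ioc_subset_Icc_self ht)
    have hre := Complex.reCLM.intervalIntegral_comp_comm hI
    rw [h, map_zero] at hre
    have hpt : ∀ x ∈ Ioo (0:ℝ) 1, Complex.reCLM ((χ₂ x : ℂ) * ((ω : ℂ) ^ 2 * (F1 u x) ^ 2 *
                  (starRingEnd ℂ) (z x))) = χ₂ x * (ω ^ 2 * (F1 u x).re ^ 2 * (z x).re) := by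
      intro x hx
      have e : F1 u x = ((F1 u x).re : ℂ) := by
        apply Complex.ext
        · simp
        · simpa using hu x (Ioo_subset_Icc_self hx)
      rw [e, ← Complex.ofReal_pow, ← Complex.ofReal_pow, ← Complex.ofReal_mul,
        Complex.reCLM_apply, Complex.re_ofReal_mul, Complex.re_ofReal_mul]
      simp
    have hae := ae_of_int_zero _ ⟨Complex.reCLM.integrable_comp hI.1,
      Complex.reCLM.integrable_comp hI.2⟩ (by
        filter_upwards [hχpos, ae_restrict_mem measurableSet_Ioo] with x hx hx'
        rw [hpt x hx']
        have := hzpos x hx'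
        positivity) hre
    filter_upwards [hae, hχpos, ae_restrict_mem measurableSet_Ioo] with x h0 hx hx'
    rw [hpt x hx'] at h0
    have a1 := hzpos x hx'
    have a2 := hω.1
    have : (F1 u x).re = 0 := by
      by_contra hne
      have : 0 < χ₂ x * (ω ^ 2 * (F1 u x).re ^ 2 * (z x).re) := by positivity
      linarith
    exact Complex.ext this (hu x (Ioo_subset_Icc_self hx'))
  have hu1' := eqOn_zero _ hu1c hu1
  have hg0 : ∀ x ∈ Icc (0:ℝ) 1, g x = 0 := by
    refine eqOn_zero _ hgc (ae_zero_of_primitive g hgi fun x hx => ?_)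
    have := hg1 x hx
    rw [hu1' x hx, hu1' 0 (by simp), zero_add] at this
    exact this.symm
  have hD0 : ∀ᵐ x ∂(volume.restrict (Ioo (0:ℝ) 1)), D2 u x = 0 := by
    refine ae_zero_of_primitive _ hD2i fun x hx => ?_
    have := hg2 x hx
    rw [hg0 x hx, hg0 0 (by simp), zero_add] at this
    exact this.symm
  have hF0 : ∀ᵐ x ∂(volume.restrict (Ioo (0:ℝ) 1)), F2 u x = 0 := by
    obtain ⟨w, wg, hwc, hw1, hwg, hwgc, -, -⟩ :=
      ode_solve q hq M hM (4 * ω ^ 2) (by positivity) 0 (F2 u) hF2i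
    obtain ⟨hd1, hd2⟩ := hw2 w (F2 u) hwc hF2i hF2s
    obtain ⟨φ, h1, h2, h3⟩ := hsurj w wg _ (fun _ => 0) hw1 hwg (hwgc.intervalIntegrable _ _)
      hd1 hd2 measurable_const (by simp)
    have h := hT0 φ h3
    rw [int_congr _ (fun x => ((‖F2 u x‖ ^ 2 : ℝ) : ℂ)) (by
      filter_upwards [h2, hu1, ae_restrict_mem measurableSet_Ioo] with x hx h0 hx'
      rw [hx, h0, h1 x (Ioo_subset_Icc_self hx'), Complex.ofReal_pow, ← Complex.mul_conj']
      simp only [map_sub, map_mul, Complex.conj_ofReal]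
      push_cast
      ring), intervalIntegral.integral_ofReal, Complex.ofReal_eq_zero] at h
    filter_upwards [ae_of_int_zero _ hF2s (ae_of_all _ fun x => by positivity) h] with x hx
    simpa using hx
  have : ⟪u, u⟫_ℂ = 0 := by
    rw [hinner]
    apply int_zero
    filter_upwards [hu1, hD0, hF0] with x a b c
    simp [a, b, c]
  exact inner_self_eq_zero.1 this

/-- For real-valued `q ∈ L^∞(0,1)` there exists `δ > 0` depending
only on `q` such that for `ω ∈ (0, δ]` the second-harmonic weak-form operator
`T_ω` has no nontrivial zero `u = (u₁, u₂)` with `u₁` real-valued (for any a.e.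
positive `χ₂ ∈ L^∞` and any `χ₁ ∈ L^∞`). Moreover, when `q ≡ 1` one may take
`δ = π/2`. -/
theorem stmt_16 (q : ℝ → ℝ) (hqmeas : Measurable q)
    (hqbdd : ∃ M : ℝ, ∀ x ∈ Icc (0:ℝ) 1, |q x| ≤ M) :
    (∃ δ : ℝ, 0 < δ ∧ SHGRealNontrivialFree q δ) ∧
      ((∀ x ∈ Icc (0:ℝ) 1, q x = 1) →
        SHGRealNontrivialFree q (Real.pi / 2)) := by
  obtain ⟨M, hM⟩ := hqbdd
  have hM0 : 0 ≤ M := (abs_nonneg _).trans (hM 0 (by simp))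
  constructor
  · refine ⟨1 / (4 * (1 + M)), by positivity, core q hqmeas M hM _ fun ω hω => ?_⟩
    obtain ⟨w, g, hw, h1, h2, hg, hw0, hg0⟩ := ode_solve q hqmeas M hM (4 * ω ^ 2)
      (by positivity) 1 (fun _ => 0) (by simp)
    refine ⟨w, g, hw, h1, h2, hg, ode_pos q M hM (4 * ω ^ 2) (by positivity) ?_ w g hw hg h1 h2
      hw0 hg0⟩
    have a := hω.2
    rw [le_div_iff₀ (by positivity)] at a
    have b := hω.1
    have c : ω ≤ 1 / 4 := by nlinarith [mul_nonneg b.le hM0]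
    have d : ω * M ≤ 1 / 4 := by nlinarith
    nlinarith [mul_nonneg b.le hM0]
  · intro hq1
    refine core q hqmeas M hM _ fun ω hω => ?_
    have hω0 : (ω : ℂ) ≠ 0 := by exact_mod_cast hω.1.ne'
    have hs : ∀ x : ℝ, HasDerivAt (fun x : ℝ => Complex.sin (2 * ω * x) / (2 * ω))
        (Complex.cos (2 * ω * x)) x := by
      intro x
      have h : HasDerivAt (fun x : ℂ => Complex.sin (2 * ω * x) / (2 * ω))
        (Complex.cos (2 * ω * x) * (2 * ω * 1) / (2 * ω)) (x : ℂ) :=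
        (((hasDerivAt_id (x : ℂ)).const_mul (2 * (ω : ℂ))).csin).div_const _
      have e : Complex.cos (2 * ω * x) * (2 * ω * 1) / (2 * ω) = Complex.cos (2 * ω * x) := by
        field_simp
      rw [e] at h
      exact h.comp_ofReal
    have hc : ∀ x : ℝ, HasDerivAt (fun x : ℝ => Complex.cos (2 * ω * x))
        (-Complex.sin (2 * ω * x) * (2 * ω * 1)) x := by
      intro x
      exact (((hasDerivAt_id (x : ℂ)).const_mul (2 * (ω : ℂ))).ccos).comp_ofReal
    refine ⟨fun x => Complex.sin (2 * ω * x) / (2 * ω), fun x => Complex.cos (2 * ω * x),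
      by fun_prop, ?_, ?_, by fun_prop, ?_⟩
    · intro x _
      rw [intervalIntegral.integral_eq_sub_of_hasDerivAt (fun t _ => hs t)
        (Continuous.intervalIntegrable (by fun_prop) _ _)]
      ring
    · intro x hx
      have e : (∫ t in (0:ℝ)..x, (0 - ((4 * ω ^ 2 : ℝ) : ℂ) * q t *
          (Complex.sin (2 * ω * t) / (2 * ω)))) =
          ∫ t in (0:ℝ)..x, (-Complex.sin (2 * ω * t) * (2 * ω * 1)) := by
        apply intervalIntegral.integral_congr
        intro t ht
        rw [uIcc_of_le hx.1] at ht
        simp only [hq1 t ⟨ht.1, ht.2.trans hx.2⟩]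
        push_cast
        field_simp
        ring
      rw [e, intervalIntegral.integral_eq_sub_of_hasDerivAt (fun t _ => hc t)
        (Continuous.intervalIntegrable (by fun_prop) _ _)]
      ring
    · intro x hx
      have e : Complex.sin (2 * ω * x) / (2 * ω) =
          ((Real.sin (2 * ω * x) / (2 * ω) : ℝ) : ℂ) := by push_cast; rfl
      simp only [e, Complex.ofReal_re]
      have a1 := hω.1
      have a2 := hω.2
      have a3 := hx.1
      refine div_pos (Real.sin_pos_of_pos_of_lt_pi (by positivity) ?_) (by positivity)
      nlinarith [hx.2, Real.pi_pos]
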